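/- Let M ≥ 2, σ > 0, σ_n > 0, ρ ∈ [0,1) and P ≥ 0, and set A = 1+(M−1)ρ. Then equality σ²·(A(1−ρ)^{M−1}σ_n²/(P·M·A + σ_n²))^{1/M} = σ²·(1 − P·A²/(P(M²ρ + M(1−ρ)) + σ_n²)) holds if and only if P = σ_n²·ρ/((1−ρ)(1+(M−1)ρ)). -/

import Mathlib

/-- Equality case of the AM–GM inequality for `M` positive numbers, `M - 1` of which equal `a`. -/
theorem pow_mul_rpow_one_div_eq_arith_mean_iff {M : ℕ} (hM : 2 ≤ M) {a b : ℝ}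
    (ha : 0 < a) (hb : 0 < b) :
    (a ^ (M - 1) * b) ^ ((1 : ℝ) / M) = (((M : ℝ) - 1) * a + b) / M ↔ a = b := by
  have hM' : (2 : ℝ) ≤ M := by exact_mod_cast hM
  have hM0 : (0 : ℝ) < M := by linarith
  have hw : 0 < ((M : ℝ) - 1) / M := div_pos (by linarith) hM0
  have hcast : ((M - 1 : ℕ) : ℝ) = (M : ℝ) - 1 := by
    rw [Nat.cast_sub (by omega), Nat.cast_one]
  have hgeom : (a ^ (M - 1) * b) ^ ((1 : ℝ) / M) =
      a ^ (((M : ℝ) - 1) / M) * b ^ ((1 : ℝ) / M) := by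
    rw [Real.mul_rpow (by positivity) hb.le, ← Real.rpow_natCast a, ← Real.rpow_mul ha.le,
      hcast, mul_one_div]
  have harith : (((M : ℝ) - 1) * a + b) / M = ((M : ℝ) - 1) / M * a + (1 : ℝ) / M * b := by
    ring
  rw [hgeom, harith]
  exact Real.geom_mean_eq_arith_mean2_weighted_iff_of_pos hw (by positivity) ha.le hb.le
    (by field_simp; ring)

/-- For `M ≥ 2`, the two cases of the distortion lower bound of Proposition 1 coincide
exactly at the threshold power `P = σ_n² ρ / ((1−ρ)(1+(M−1)ρ))`. -/
theorem lower_bound_eq_uncoded_iff (M : ℕ) (hM : 2 ≤ M) (σ σn ρ P : ℝ)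
    (hσ : 0 < σ) (hσn : 0 < σn) (hρ0 : 0 ≤ ρ) (hρ1 : ρ < 1) (hP : 0 ≤ P) :
    σ ^ 2 * ((1 + ((M : ℝ) - 1) * ρ) * (1 - ρ) ^ (M - 1) * σn ^ 2 /
        (P * M * (1 + ((M : ℝ) - 1) * ρ) + σn ^ 2)) ^ ((1 : ℝ) / M) =
      σ ^ 2 * (1 - P * (1 + ((M : ℝ) - 1) * ρ) ^ 2 /
        (P * ((M : ℝ) ^ 2 * ρ + (M : ℝ) * (1 - ρ)) + σn ^ 2)) ↔
      P = σn ^ 2 * ρ / ((1 - ρ) * (1 + ((M : ℝ) - 1) * ρ)) := by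
  have hM' : (2 : ℝ) ≤ M := by exact_mod_cast hM
  have hA : 0 < 1 + ((M : ℝ) - 1) * ρ := by nlinarith
  have hr : 0 < 1 - ρ := by linarith
  have hD : 0 < P * M * (1 + ((M : ℝ) - 1) * ρ) + σn ^ 2 := by positivity
  have hden : P * ((M : ℝ) ^ 2 * ρ + (M : ℝ) * (1 - ρ)) + σn ^ 2 =
      P * M * (1 + ((M : ℝ) - 1) * ρ) + σn ^ 2 := by ring
  have hlhs : (1 + ((M : ℝ) - 1) * ρ) * (1 - ρ) ^ (M - 1) * σn ^ 2 /
        (P * M * (1 + ((M : ℝ) - 1) * ρ) + σn ^ 2) =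
      (1 - ρ) ^ (M - 1) * ((1 + ((M : ℝ) - 1) * ρ) * σn ^ 2 /
        (P * M * (1 + ((M : ℝ) - 1) * ρ) + σn ^ 2)) := by ring
  have hrhs : 1 - P * (1 + ((M : ℝ) - 1) * ρ) ^ 2 /
        (P * M * (1 + ((M : ℝ) - 1) * ρ) + σn ^ 2) =
      (((M : ℝ) - 1) * (1 - ρ) + (1 + ((M : ℝ) - 1) * ρ) * σn ^ 2 /
        (P * M * (1 + ((M : ℝ) - 1) * ρ) + σn ^ 2)) / M := by
    field_simp
    ring
  rw [mul_right_inj' (by positivity), hden, hlhs, hrhs,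
    pow_mul_rpow_one_div_eq_arith_mean_iff hM hr (by positivity),
    eq_div_iff hD.ne', eq_div_iff (by positivity)]
  have hM0 : (M : ℝ) ≠ 0 := by linarith
  constructor
  · intro h
    apply mul_left_cancel₀ hM0
    linear_combination h
  · intro h
    linear_combination (M : ℝ) * h
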